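/- Let K be an algebraically closed field of characteristic 0 and let (A, μ, α, β) be the 2-dimensional unital BiHom-associative algebra Hu²₃ on A = K² with basis {e1, e2}, unit e1, defined by μ(e1,e1)=e1, μ(e1,e2)=−e2, μ(e2,e1)=−e2, μ(e2,e2)=e1, α(e1)=β(e1)=e1, α(e2)=β(e2)=−e2. Then there exist no K-linear maps Δ : A → A ⊗ A, ψ, ω : A → A and ε : A → K such that (A, μ, Δ, α, β, ψ, ω) is a BiHom-bialgebra which is unital with unit e1 and counital with counit ε. -/

import Mathlib

open TensorProduct

/-- A BiHom-associative algebra structure on a `K`-vector space `A`. -/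
def IsBiHomAssociative {K : Type*} [Field K] {A : Type*} [AddCommGroup A] [Module K A]
    (μ : A →ₗ[K] A →ₗ[K] A) (α β : A →ₗ[K] A) : Prop :=
  (∀ x, α (β x) = β (α x)) ∧
  (∀ x y, α (μ x y) = μ (α x) (α y)) ∧
  (∀ x y, β (μ x y) = μ (β x) (β y)) ∧
  (∀ x y z, μ (α x) (μ y z) = μ (μ x y) (β z))

/-- `(A, μ, α, β)` is unital with unit `u`. -/
def IsBiHomUnit {K : Type*} [Field K] {A : Type*} [AddCommGroup A] [Module K A]
    (μ : A →ₗ[K] A →ₗ[K] A) (α β : A →ₗ[K] A) (u : A) : Prop :=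
  α u = u ∧ β u = u ∧ (∀ x, μ x u = α x) ∧ (∀ x, μ u x = β x)

/-- `(A, μ, Δ, α, β, ψ, ω)` is a BiHom-bialgebra. -/
def IsBiHomBialgebra {K : Type*} [Field K] {A : Type*} [AddCommGroup A] [Module K A]
    (μ : A →ₗ[K] A →ₗ[K] A) (Δ : A →ₗ[K] A ⊗[K] A) (α β ψ ω : A →ₗ[K] A) : Prop :=
  IsBiHomAssociative μ α β ∧
  (∀ x, ψ (ω x) = ω (ψ x)) ∧
  (TensorProduct.map ψ ψ ∘ₗ Δ = Δ ∘ₗ ψ) ∧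
  (TensorProduct.map ω ω ∘ₗ Δ = Δ ∘ₗ ω) ∧
  ((TensorProduct.assoc K A A A).toLinearMap ∘ₗ TensorProduct.map Δ ψ ∘ₗ Δ
    = TensorProduct.map ω Δ ∘ₗ Δ) ∧
  (∀ x y, Δ (μ x y) = TensorProduct.map₂ μ μ (Δ x) (Δ y)) ∧
  (∀ x, α (ψ x) = ψ (α x)) ∧
  (∀ x, α (ω x) = ω (α x)) ∧
  (∀ x, β (ψ x) = ψ (β x)) ∧
  (∀ x, β (ω x) = ω (β x)) ∧
  (TensorProduct.map α α ∘ₗ Δ = Δ ∘ₗ α) ∧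
  (TensorProduct.map β β ∘ₗ Δ = Δ ∘ₗ β) ∧
  (∀ x y, ψ (μ x y) = μ (ψ x) (ψ y)) ∧
  (∀ x y, ω (μ x y) = μ (ω x) (ω y))

/-- The BiHom-bialgebra `(A, μ, Δ, α, β, ψ, ω)` is unital with unit `u` and
counital with counit `ε`. -/
def IsUnitalCounitalBiHomBialgebra {K : Type*} [Field K] {A : Type*}
    [AddCommGroup A] [Module K A]
    (μ : A →ₗ[K] A →ₗ[K] A) (Δ : A →ₗ[K] A ⊗[K] A) (α β ψ ω : A →ₗ[K] A)
    (u : A) (ε : A →ₗ[K] K) : Prop :=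
  IsBiHomBialgebra μ Δ α β ψ ω ∧
  IsBiHomUnit μ α β u ∧
  Δ u = u ⊗ₜ[K] u ∧
  ε u = 1 ∧
  ψ u = u ∧
  ω u = u ∧
  (∀ x, ε (ψ x) = ε x) ∧
  (∀ x, ε (ω x) = ε x) ∧
  (∀ x, ε (α x) = ε x) ∧
  (∀ x, ε (β x) = ε x) ∧
  (∀ x y, ε (μ x y) = ε x * ε y) ∧
  ((TensorProduct.rid K A).toLinearMap ∘ₗ TensorProduct.map LinearMap.id ε ∘ₗ Δ = ω) ∧
  ((TensorProduct.lid K A).toLinearMap ∘ₗ TensorProduct.map ε LinearMap.id ∘ₗ Δ = ψ)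

/-- The bilinear multiplication on `Fin n → K` with structure constants `C`. -/
def mulOf {K : Type*} [Field K] {n : ℕ} (C : Fin n → Fin n → Fin n → K) :
    (Fin n → K) →ₗ[K] (Fin n → K) →ₗ[K] (Fin n → K) :=
  LinearMap.mk₂ K (fun x y k => ∑ i, ∑ j, x i * y j * C i j k)
    (fun x x' y => by
      funext k
      simp [add_mul, Finset.sum_add_distrib])
    (fun c x y => by
      funext k
      simp [Finset.mul_sum, mul_assoc])
    (fun x y y' => by
      funext k
      simp [mul_add, add_mul, Finset.sum_add_distrib])
    (fun c x y => by
      funext k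
      simp only [Pi.smul_apply, smul_eq_mul, Finset.mul_sum]
      congr 1; funext i; congr 1; funext j; ring)

/-- The linear map on `Fin n → K` sending the `i`-th standard basis vector to
the vector `M i`. -/
def linOf {K : Type*} [Field K] {n : ℕ} (M : Fin n → Fin n → K) :
    (Fin n → K) →ₗ[K] (Fin n → K) :=
  Matrix.mulVecLin (Matrix.of M).transpose

/-- There is no unital counital BiHom-bialgebra structure (with unit `e₁`)
whose underlying unital BiHom-associative algebra is the two-dimensional
algebra `Hu²₃` given by `e₁e₁ = e₁`, `e₁e₂ = -e₂`, `e₂e₁ = -e₂`, `e₂e₂ = e₁`,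
`α(e₁) = β(e₁) = e₁`, `α(e₂) = β(e₂) = -e₂`. -/
theorem no_unital_bialgebra_on_Hu23 {K : Type*} [Field K] [IsAlgClosed K] [CharZero K] :
    ¬ ∃ (Δ : (Fin 2 → K) →ₗ[K] (Fin 2 → K) ⊗[K] (Fin 2 → K))
        (ψ ω : (Fin 2 → K) →ₗ[K] (Fin 2 → K)) (ε : (Fin 2 → K) →ₗ[K] K),
      IsUnitalCounitalBiHomBialgebra
        (mulOf (![![![1,0],![0,-1]], ![![0,-1],![1,0]]] : Fin 2 → Fin 2 → Fin 2 → K))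
        Δ
        (linOf (![![1,0],![0,-1]] : Fin 2 → Fin 2 → K))
        (linOf (![![1,0],![0,-1]] : Fin 2 → Fin 2 → K))
        ψ ω
        (![1,0] : Fin 2 → K)
        ε := by
  rintro ⟨Δ, ψ, ω, ε, -, -, -, hε_unit, -, -, -, -, hεα, -, hε_mul, -, -⟩
  have h_neg := hεα ![0, 1]
  have h_sq := hε_mul ![0, 1] ![0, 1]
  have hα : linOf (![![1,0],![0,-1]] : Fin 2 → Fin 2 → K) ![0, 1] = -![0, 1] := by
    ext i
    fin_cases i <;> simp [linOf]
  have hμ : mulOf (![![![1,0],![0,-1]], ![![0,-1],![1,0]]] : Fin 2 → Fin 2 → Fin 2 → K)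
      ![0, 1] ![0, 1] = ![1, 0] := by
    ext i
    fin_cases i <;> simp [mulOf]
  rw [hα, map_neg, neg_eq_self] at h_neg
  rw [hμ, hε_unit, h_neg, mul_zero] at h_sq
  exact one_ne_zero h_sq
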